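/- Let f : ℝ^p → ℝ be differentiable, convex and L-smooth with L > 0, let x⋆ be a point with ∇f(x⋆) = 0, let β_k ∈ ℝ, and let μ_k, μ_{k+1} be reals with 0 ≤ μ_k ≤ μ_{k+1}. Given x_k, x_{k−1} ∈ ℝ^p, set y_k = (1+β_k)x_k − β_kx_{k−1} and x_{k+1} = y_k − (1/L)∇f(y_k). Then μ_k·( ⟨∇f(y_k), x_k − y_k⟩ + (1/(2L))‖∇f(y_k)‖² ) + (μ_{k+1} − μ_k)·( ⟨∇f(y_k), x⋆ − y_k⟩ + (1/(2L))‖∇f(y_k)‖² ) ≤ μ_k(f(x_k) − f(x⋆)) − μ_{k+1}(f(x_{k+1}) − f(x⋆)). -/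

import Mathlib

open RealInnerProductSpace

/-- The descent lemma: a function whose gradient is `L`-Lipschitz is bounded above by its
quadratic model. -/
theorem le_add_inner_gradient_add_sq {E : Type*} [NormedAddCommGroup E] [InnerProductSpace ℝ E]
    [CompleteSpace E] {f : E → ℝ} {L : ℝ} (hf : Differentiable ℝ f)
    (hsmooth : ∀ x y, ‖gradient f x - gradient f y‖ ≤ L * ‖x - y‖) (y v : E) :
    f (y + v) ≤ f y + ⟪gradient f y, v⟫ + L / 2 * ‖v‖ ^ 2 := by
  have hderiv (t : ℝ) :
      HasDerivAt (fun t : ℝ ↦ f (y + t • v) - t * ⟪gradient f y, v⟫ - L / 2 * ‖v‖ ^ 2 * t ^ 2)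
        (⟪gradient f (y + t • v) - gradient f y, v⟫ - L * ‖v‖ ^ 2 * t) t := by
    have hline : HasDerivAt (fun t : ℝ ↦ y + t • v) v t := by
      simpa using ((hasDerivAt_id t).smul_const v).const_add y
    have hcomp := (hf (y + t • v)).hasGradientAt.hasFDerivAt.comp_hasDerivAt t hline
    have hquad := ((hasDerivAt_id t).pow 2).const_mul (L / 2 * ‖v‖ ^ 2)
    refine ((hcomp.sub ((hasDerivAt_id t).mul_const ⟪gradient f y, v⟫)).sub hquad).congr_deriv ?_
    simp [inner_sub_left]
    ring
  have hanti := antitoneOn_of_deriv_nonpos (convex_Icc (0 : ℝ) 1)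
    (fun t _ ↦ (hderiv t).continuousAt.continuousWithinAt)
    (fun t _ ↦ (hderiv t).differentiableAt.differentiableWithinAt) fun t ht ↦ by
      rw [interior_Icc] at ht
      rw [(hderiv t).deriv, sub_nonpos]
      calc ⟪gradient f (y + t • v) - gradient f y, v⟫
          ≤ ‖gradient f (y + t • v) - gradient f y‖ * ‖v‖ := real_inner_le_norm _ _
        _ ≤ L * ‖y + t • v - y‖ * ‖v‖ := by gcongr; exact hsmooth _ _
        _ = L * ‖v‖ ^ 2 * t := by
          rw [add_sub_cancel_left, norm_smul, Real.norm_of_nonneg ht.1.le]; ring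
  have := hanti (Set.left_mem_Icc.2 zero_le_one) (Set.right_mem_Icc.2 zero_le_one) zero_le_one
  simp only [one_smul, zero_smul, add_zero] at this
  linarith

/-- A gradient step of length `1 / L` decreases the function by at least
`‖gradient f y‖ ^ 2 / (2 * L)`. -/
theorem gradient_step_le {E : Type*} [NormedAddCommGroup E] [InnerProductSpace ℝ E]
    [CompleteSpace E] {f : E → ℝ} {L : ℝ} (hL : 0 < L) (hf : Differentiable ℝ f)
    (hsmooth : ∀ x y, ‖gradient f x - gradient f y‖ ≤ L * ‖x - y‖) (y : E) :
    f (y - (1 / L) • gradient f y) ≤ f y - 1 / (2 * L) * ‖gradient f y‖ ^ 2 := by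
  have h := le_add_inner_gradient_add_sq hf hsmooth y (-((1 / L) • gradient f y))
  rw [← sub_eq_add_neg, inner_neg_right, real_inner_smul_right, real_inner_self_eq_norm_sq,
    norm_neg, norm_smul, Real.norm_of_nonneg (by positivity)] at h
  refine h.trans_eq ?_
  field_simp
  ring

/-- Time-dependent supply-rate condition of Lemma 8 (with supply rate
`X_k = μ_kM_k + (μ_{k+1} − μ_k)N_k`) used in the `O(1/k²)` analysis of Nesterov's method. -/
theorem nesterov_weakly_convex_supply_rate {p : ℕ} (f : EuclideanSpace ℝ (Fin p) → ℝ)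
    (L : ℝ) (hL : 0 < L)
    (hf : Differentiable ℝ f)
    (hconv : ∀ x y, f x ≥ f y + ⟪gradient f y, x - y⟫)
    (hsmooth : ∀ x y, ‖gradient f x - gradient f y‖ ≤ L * ‖x - y‖)
    (xs : EuclideanSpace ℝ (Fin p)) (hxs : gradient f xs = 0)
    (βk μk μkp1 : ℝ) (hμ0 : 0 ≤ μk) (hμ : μk ≤ μkp1)
    (xk xkm1 yk xkp1 : EuclideanSpace ℝ (Fin p))
    (hy : yk = (1 + βk) • xk - βk • xkm1)
    (hx : xkp1 = yk - (1 / L) • gradient f yk) :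
    μk * (⟪gradient f yk, xk - yk⟫ + 1 / (2 * L) * ‖gradient f yk‖ ^ 2)
      + (μkp1 - μk) * (⟪gradient f yk, xs - yk⟫ + 1 / (2 * L) * ‖gradient f yk‖ ^ 2)
      ≤ μk * (f xk - f xs) - μkp1 * (f xkp1 - f xs) := by
  have hstep := gradient_step_le hL hf hsmooth yk
  rw [← hx] at hstep
  have h₁ : ⟪gradient f yk, xk - yk⟫ + 1 / (2 * L) * ‖gradient f yk‖ ^ 2 ≤ f xk - f xkp1 := by
    linarith [hconv xk yk]
  have h₂ : ⟪gradient f yk, xs - yk⟫ + 1 / (2 * L) * ‖gradient f yk‖ ^ 2 ≤ f xs - f xkp1 := by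
    linarith [hconv xs yk]
  linarith [mul_le_mul_of_nonneg_left h₁ hμ0, mul_le_mul_of_nonneg_left h₂ (sub_nonneg.2 hμ)]
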